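/- arXiv:1901.00844 — 3 statements merged into one kernel-verified Lean document; each statement's English description precedes it below -/
import Mathlib

section
/- Let λ ∈ [0, 1), let A : ℝ^d → ℝ^{s'} be a linear map with operator norm ‖A‖ (with respect to Euclidean norms), and let (Δ(t))_{t≥0}, (g(t))_{t≥0}, (g^sp(t))_{t≥0} be sequences of vectors in ℝ^d satisfying, for every t ≥ 0: Δ(0) = 0, Δ(t+1) = g(t) + Δ(t) − g^sp(t), ‖Δ(t+1)‖ ≤ λ‖g(t) + Δ(t)‖, and ‖g^sp(t)‖ ≤ ‖g(t) + Δ(t)‖. Then for every t ≥ 0, ‖A g^sp(t)‖ ≤ ‖A‖ · ∑_{i=0}^{t} λ^{t−i} ‖g(i)‖. -/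
/-- Bound on the compressed sparsified gradient:
`‖A g^sp(t)‖ ≤ ‖A‖ · ∑_{i=0}^{t} λ^{t-i} ‖g(i)‖`. -/
theorem compressed_sparsified_gradient_bound (d s' : ℕ) (lam : ℝ)
    (hlam : lam ∈ Set.Ico (0 : ℝ) 1)
    (A : EuclideanSpace ℝ (Fin d) →L[ℝ] EuclideanSpace ℝ (Fin s'))
    (Δ g gsp : ℕ → EuclideanSpace ℝ (Fin d))
    (h0 : Δ 0 = 0)
    (hupd : ∀ t : ℕ, Δ (t + 1) = g t + Δ t - gsp t)
    (hΔ : ∀ t : ℕ, ‖Δ (t + 1)‖ ≤ lam * ‖g t + Δ t‖)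
    (hsp : ∀ t : ℕ, ‖gsp t‖ ≤ ‖g t + Δ t‖) :
    ∀ t : ℕ, ‖A (gsp t)‖ ≤ ‖A‖ * ∑ i ∈ Finset.range (t + 1), lam ^ (t - i) * ‖g i‖ := by
  have key : ∀ t : ℕ, ‖g t + Δ t‖ ≤
      ∑ i ∈ Finset.range (t + 1), lam ^ (t - i) * ‖g i‖ := by
    intro t
    induction t with
    | zero => simp [h0]
    | succ n ih =>
      have hs : ∑ i ∈ Finset.range (n + 1), lam ^ (n + 1 - i) * ‖g i‖ =
          lam * ∑ i ∈ Finset.range (n + 1), lam ^ (n - i) * ‖g i‖ := by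
        rw [Finset.mul_sum]
        refine Finset.sum_congr rfl fun i hi => ?_
        have hi' := Finset.mem_range.mp hi
        rw [show n + 1 - i = (n - i) + 1 by omega, pow_succ]
        ring
      rw [Finset.sum_range_succ, hs, Nat.sub_self, pow_zero, one_mul]
      have h1 := norm_add_le (g (n + 1)) (Δ (n + 1))
      have h2 := hΔ n
      have h3 := mul_le_mul_of_nonneg_left ih hlam.1
      linarith
  intro t
  exact (A.le_opNorm _).trans
    (mul_le_mul_of_nonneg_left ((hsp t).trans (key t)) (norm_nonneg _))
end

section
/- Under the setup and hypotheses described in the context (Lemma 4 of the paper), the expected effective noise level satisfies E[σ_ω(t)] ≤ (σ / (M √(P_t))) · ( σ_max · ((1 − λ^{t+1})/(1 − λ)) · G + 1 ). -/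
open MeasureTheory

/-- Lemma 4 of the paper: under the A-DSGD setup, the expected effective noise level
`E[σ_ω(t)] = E[σ / ∑_m √(P_t/(‖A g_m^sp(t)‖² + 1))]` is bounded by
`(σ/(M √P_t)) (σ_max ((1-λ^{t+1})/(1-λ)) G + 1)`. -/
theorem expected_effective_noise_bound
    {Ω : Type*} [MeasurableSpace Ω] (μ : Measure Ω) [IsProbabilityMeasure μ]
    (M d s' : ℕ) (hM : 1 ≤ M) (hd : 1 ≤ d) (hs' : 1 ≤ s') (t : ℕ)
    (lam σ Pt G σmax : ℝ)
    (hlam : lam ∈ Set.Ioo (0 : ℝ) 1) (hσ : 0 < σ) (hPt : 0 < Pt)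
    (hG : 0 < G) (hσmax : 0 < σmax)
    (A : EuclideanSpace ℝ (Fin d) →L[ℝ] EuclideanSpace ℝ (Fin s')) (hA : ‖A‖ ≤ σmax)
    (g gsp Δ : Fin M → ℕ → Ω → EuclideanSpace ℝ (Fin d))
    (hmeas : ∀ m, ∀ i ≤ t, Measurable (g m i) ∧ Measurable (gsp m i) ∧ Measurable (Δ m i))
    (hint : ∀ m, ∀ i ≤ t, Integrable (fun ω => ‖g m i ω‖) μ ∧
        Integrable (fun ω => ‖gsp m i ω‖) μ ∧ Integrable (fun ω => ‖Δ m i ω‖) μ)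
    (h0 : ∀ m, ∀ᵐ ω ∂μ, Δ m 0 ω = 0)
    (hupd : ∀ m, ∀ i < t, ∀ᵐ ω ∂μ, Δ m (i + 1) ω = g m i ω + Δ m i ω - gsp m i ω)
    (hΔ : ∀ m, ∀ i < t, ∀ᵐ ω ∂μ, ‖Δ m (i + 1) ω‖ ≤ lam * ‖g m i ω + Δ m i ω‖)
    (hsp : ∀ m, ∀ i ≤ t, ∀ᵐ ω ∂μ, ‖gsp m i ω‖ ≤ ‖g m i ω + Δ m i ω‖)
    (hG1 : ∀ i ≤ t, (1 / (M : ℝ)) * ∑ m, ∫ ω, ‖g m i ω‖ ∂μ ≤ G) :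
    ∫ ω, σ / (∑ m, Real.sqrt (Pt / (‖A (gsp m t ω)‖ ^ 2 + 1))) ∂μ
      ≤ σ / (M * Real.sqrt Pt) * (σmax * ((1 - lam ^ (t + 1)) / (1 - lam)) * G + 1) := by
  obtain ⟨hl0, hl1⟩ := hlam
  have hMpos : (0 : ℝ) < M := by exact_mod_cast hM
  have hP : 0 < Real.sqrt Pt := Real.sqrt_pos.mpr hPt
  have h1l : 0 < 1 - lam := by linarith
  -- error recursion
  have hS : ∀ i ≤ t, (1 / (M : ℝ)) * ∑ m, ∫ ω, ‖Δ m i ω‖ ∂μ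
      ≤ (1 - lam ^ (i + 1)) / (1 - lam) * G - G := by
    intro i
    induction i with
    | zero =>
      intro _
      have hz : ∀ m, ∫ ω, ‖Δ m 0 ω‖ ∂μ = 0 := by
        intro m
        apply integral_eq_zero_of_ae
        filter_upwards [h0 m] with ω hω
        simp [hω]
      simp [hz, div_self h1l.ne']
    | succ i ih =>
      intro hi
      have ih' := ih (by omega)
      have hg := hG1 i (by omega)
      have hb : ∀ m, ∫ ω, ‖Δ m (i+1) ω‖ ∂μ
          ≤ lam * (∫ ω, ‖g m i ω‖ ∂μ + ∫ ω, ‖Δ m i ω‖ ∂μ) := by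
        intro m
        obtain ⟨i1, -, i3⟩ := hint m i (by omega)
        rw [← integral_add i1 i3, ← integral_const_mul]
        apply integral_mono_ae (hint m (i+1) hi).2.2 ((i1.add i3).const_mul lam)
        filter_upwards [hΔ m i (by omega)] with ω hω
        exact hω.trans (mul_le_mul_of_nonneg_left (norm_add_le _ _) hl0.le)
      have hsum := Finset.sum_le_sum (fun m (_ : m ∈ Finset.univ) => hb m)
      rw [← Finset.mul_sum, Finset.sum_add_distrib] at hsum
      have h1 := mul_le_mul_of_nonneg_left hsum (by positivity : (0:ℝ) ≤ 1 / M)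
      have h2 := mul_le_mul_of_nonneg_left (add_le_add hg ih') hl0.le
      have h3 : lam * (G + ((1 - lam ^ (i + 1)) / (1 - lam) * G - G))
          = (1 - lam ^ (i + 1 + 1)) / (1 - lam) * G - G := by
        field_simp
        ring
      rw [← h3]
      refine h1.trans (le_trans (le_of_eq ?_) h2)
      ring
  have hE : (1 / (M : ℝ)) * ∑ m, ∫ ω, ‖gsp m t ω‖ ∂μ
      ≤ (1 - lam ^ (t + 1)) / (1 - lam) * G := by
    have hb : ∀ m, ∫ ω, ‖gsp m t ω‖ ∂μ
        ≤ ∫ ω, ‖g m t ω‖ ∂μ + ∫ ω, ‖Δ m t ω‖ ∂μ := by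
      intro m
      obtain ⟨i1, i2, i3⟩ := hint m t le_rfl
      rw [← integral_add i1 i3]
      apply integral_mono_ae i2 (i1.add i3)
      filter_upwards [hsp m t le_rfl] with ω hω
      exact hω.trans (norm_add_le _ _)
    have hsum := Finset.sum_le_sum (fun m (_ : m ∈ Finset.univ) => hb m)
    rw [Finset.sum_add_distrib] at hsum
    have h1 := mul_le_mul_of_nonneg_left hsum (by positivity : (0:ℝ) ≤ 1 / M)
    have h2 := hS t le_rfl
    have h3 := hG1 t le_rfl
    rw [mul_add] at h1
    linarith
  have hintb : ∀ m, Integrable (fun ω => σmax * ‖gsp m t ω‖ + 1) μ := fun m =>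
    ((hint m t le_rfl).2.1.const_mul σmax).add (integrable_const 1)
  have hpt : ∀ ω, σ / (∑ m, Real.sqrt (Pt / (‖A (gsp m t ω)‖ ^ 2 + 1)))
      ≤ σ / (Real.sqrt Pt * M ^ 2) * ∑ m, (σmax * ‖gsp m t ω‖ + 1) := by
    intro ω
    have hy : ∀ m, 0 < σmax * ‖gsp m t ω‖ + 1 := fun m => by positivity
    have hlow : ∀ m, Real.sqrt Pt * (σmax * ‖gsp m t ω‖ + 1)⁻¹
        ≤ Real.sqrt (Pt / (‖A (gsp m t ω)‖ ^ 2 + 1)) := by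
      intro m
      rw [Real.sqrt_div hPt.le, div_eq_mul_inv]
      apply mul_le_mul_of_nonneg_left _ hP.le
      apply inv_anti₀ (by positivity)
      rw [Real.sqrt_le_left (hy m).le]
      have hx : ‖A (gsp m t ω)‖ ≤ σmax * ‖gsp m t ω‖ := A.le_of_opNorm_le hA _
      have := norm_nonneg (A (gsp m t ω))
      nlinarith
    have hsl := Finset.sum_le_sum (fun m (_ : m ∈ Finset.univ) => hlow m)
    rw [← Finset.mul_sum] at hsl
    have hcs := Finset.sum_sq_le_sum_mul_sum_of_sq_eq_mul (Finset.univ : Finset (Fin M))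
      (r := fun _ => (1 : ℝ)) (f := fun m => σmax * ‖gsp m t ω‖ + 1)
      (g := fun m => (σmax * ‖gsp m t ω‖ + 1)⁻¹)
      (fun m _ => (hy m).le) (fun m _ => (inv_pos.mpr (hy m)).le)
      (fun m _ => by rw [mul_inv_cancel₀ (hy m).ne']; norm_num)
    simp only [Finset.sum_const, Finset.card_univ, Fintype.card_fin, nsmul_eq_mul, mul_one] at hcs
    haveI : Nonempty (Fin M) := ⟨⟨0, hM⟩⟩
    have hipos : 0 < ∑ m, (σmax * ‖gsp m t ω‖ + 1)⁻¹ :=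
      Finset.sum_pos (fun m _ => inv_pos.mpr (hy m)) Finset.univ_nonempty
    have hden := (mul_pos hP hipos).trans_le hsl
    have hypos : 0 < ∑ m, (σmax * ‖gsp m t ω‖ + 1) :=
      Finset.sum_pos (fun m _ => hy m) Finset.univ_nonempty
    rw [div_mul_eq_mul_div, div_le_div_iff₀ hden (by positivity), mul_assoc]
    apply mul_le_mul_of_nonneg_left _ hσ.le
    calc Real.sqrt Pt * (M : ℝ) ^ 2
        ≤ Real.sqrt Pt * ((∑ m, (σmax * ‖gsp m t ω‖ + 1)) *
            ∑ m, (σmax * ‖gsp m t ω‖ + 1)⁻¹) := mul_le_mul_of_nonneg_left hcs hP.le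
      _ = (∑ m, (σmax * ‖gsp m t ω‖ + 1)) *
            (Real.sqrt Pt * ∑ m, (σmax * ‖gsp m t ω‖ + 1)⁻¹) := by ring
      _ ≤ _ := mul_le_mul_of_nonneg_left hsl hypos.le
  have hI := integral_mono_of_nonneg (μ := μ)
    (f := fun ω => σ / (∑ m, Real.sqrt (Pt / (‖A (gsp m t ω)‖ ^ 2 + 1))))
    (Filter.Eventually.of_forall fun ω => by
      simp only [Pi.zero_apply]
      exact div_nonneg hσ.le (Finset.sum_nonneg fun m _ => Real.sqrt_nonneg _))
    ((integrable_finsetSum Finset.univ (fun m _ => hintb m)).const_mul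
      (σ / (Real.sqrt Pt * M ^ 2)))
    (Filter.Eventually.of_forall hpt)
  refine hI.trans ?_
  rw [integral_const_mul, integral_finsetSum Finset.univ (fun m _ => hintb m)]
  have hv : ∀ m, ∫ ω, (σmax * ‖gsp m t ω‖ + 1) ∂μ = σmax * ∫ ω, ‖gsp m t ω‖ ∂μ + 1 := by
    intro m
    rw [integral_add ((hint m t le_rfl).2.1.const_mul σmax) (integrable_const 1),
      integral_const_mul]
    simp
  simp only [hv, Finset.sum_add_distrib, ← Finset.mul_sum, Finset.sum_const, Finset.card_univ,
    Fintype.card_fin, nsmul_eq_mul, mul_one]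
  have hfin := mul_le_mul_of_nonneg_left
    (add_le_add_left (mul_le_mul_of_nonneg_left hE hσmax.le) 1)
    (by positivity : 0 ≤ σ / (M * Real.sqrt Pt))
  rw [mul_assoc σmax]
  refine le_trans (le_of_eq ?_) hfin
  field_simp
end

section
/- Under the setup described in the context (Theorem 1 of the paper), suppose additionally that W_0(θ_0) = (ε/(2ηcε − η²G²)) · log( e ‖θ_0 − θ*‖² / ε ) with θ_0 = 0 and 2ηcε − η²G² > 0, and that T − ηL ∑_{t=0}^{T−1} v(t) > 0. Then the probability that the process does not enter the success region by time T is bounded as P(E_T) ≤ ε / ( (2ηcε − η²G²) · (T − ηL ∑_{t=0}^{T−1} v(t)) ) · log( e ‖θ*‖² / ε ). -/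
open MeasureTheory

/-- Theorem 1 of the paper: given a nonnegative `L`-Lipschitz rate supermartingale `W`
for the perturbed process `θ_{t+1} = (θ_t − η ḡ_t) + p_t` with `E[‖p_t‖ | F_t] ≤ η v(t)`,
the probability of not entering the success region `S = {θ : ‖θ − θ*‖² ≤ ε}` by time `T`
is bounded by `ε log(e‖θ*‖²/ε) / ((2ηcε − η²G²)(T − ηL ∑_{t<T} v(t)))`. -/
theorem rate_supermartingale_failure_bound
    {Ω : Type*} {m0 : MeasurableSpace Ω} (μ : Measure Ω) [IsProbabilityMeasure μ]
    (d T : ℕ) (hd : 1 ≤ d) (hT : 1 ≤ T)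
    (ε c G η L : ℝ) (hε : 0 < ε) (hc : 0 < c) (hG : 0 < G) (hη : 0 < η)
    (hden : 0 < 2 * η * c * ε - η ^ 2 * G ^ 2)
    (hL : L = 2 * Real.sqrt ε / (2 * η * c * ε - η ^ 2 * G ^ 2))
    (θs : EuclideanSpace ℝ (Fin d))
    (v : ℕ → ℝ) (hv : ∀ t, 0 ≤ v t)
    (ℱ : Filtration ℕ m0)
    (θ gbar p : ℕ → Ω → EuclideanSpace ℝ (Fin d))
    (hadapted : ∀ t, StronglyMeasurable[ℱ t] (θ t))
    (hgmeas : ∀ t, StronglyMeasurable[ℱ (t + 1)] (gbar t))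
    (hθ0 : ∀ ω, θ 0 ω = 0)
    (hupdate : ∀ t < T, ∀ ω, θ (t + 1) ω = (θ t ω - η • gbar t ω) + p t ω)
    (hpint : ∀ t < T, Integrable (fun ω => ‖p t ω‖) μ)
    (hp : ∀ t < T, ∀ᵐ ω ∂μ, (μ[(fun ω' => ‖p t ω'‖) | ℱ t]) ω ≤ η * v t)
    (S : Set (EuclideanSpace ℝ (Fin d))) (hS : S = {θ' | ‖θ' - θs‖ ^ 2 ≤ ε})
    (A : ℕ → Set Ω) (hA : ∀ t, A t = {ω | ∀ i ≤ t, θ i ω ∉ S})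
    (W : (t : ℕ) → EuclideanSpace ℝ (Fin d) → (ℕ → EuclideanSpace ℝ (Fin d)) → ℝ)
    (hWnonneg : ∀ t x h, 0 ≤ W t x h)
    (hWint : ∀ t ≤ T, Integrable (fun ω => W t (θ t ω) (fun i => θ i ω)) μ)
    (hWint' : ∀ t < T,
        Integrable (fun ω => W (t + 1) (θ t ω - η • gbar t ω) (fun i => θ i ω)) μ)
    -- (i) supermartingale property on the event of not having succeeded yet
    (hsuper : ∀ t < T, ∀ᵐ ω ∂μ, ω ∈ A t →
        (μ[(fun ω' => W (t + 1) (θ t ω' - η • gbar t ω') (fun i => θ i ω')) | ℱ t]) ω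
          ≤ W t (θ t ω) (fun i => θ i ω))
    -- (ii) freezing after success
    (hfreeze : ∀ t < T, ∀ ω, ω ∉ A t → ∀ x : EuclideanSpace ℝ (Fin d),
        W (t + 1) x (fun i => θ i ω) = W t (θ t ω) (fun i => θ i ω))
    -- (iii) rate property on the failure event
    (hrate : ∀ ω ∈ A T, (T : ℝ) ≤ W T (θ T ω) (fun i => θ i ω))
    -- (iv) `L`-Lipschitz in the first coordinate
    (hlip : ∀ t < T, ∀ ω, ∀ x y : EuclideanSpace ℝ (Fin d),
        |W (t + 1) y (fun i => θ i ω) - W (t + 1) x (fun i => θ i ω)| ≤ L * ‖y - x‖)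
    -- (v) lower bound on the terminal value
    (hfloor : ∀ᵐ ω ∂μ,
        η * L * ∑ t ∈ Finset.range T, v t ≤ W T (θ T ω) (fun i => θ i ω))
    -- initial value of the rate supermartingale
    (hW0 : ∀ ω, W 0 (θ 0 ω) (fun i => θ i ω)
        = ε / (2 * η * c * ε - η ^ 2 * G ^ 2)
            * Real.log (Real.exp 1 * ‖θ 0 ω - θs‖ ^ 2 / ε))
    (hpos : 0 < (T : ℝ) - η * L * ∑ t ∈ Finset.range T, v t) :
    (μ (A T)).toReal
      ≤ ε / ((2 * η * c * ε - η ^ 2 * G ^ 2)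
            * ((T : ℝ) - η * L * ∑ t ∈ Finset.range T, v t))
          * Real.log (Real.exp 1 * ‖θs‖ ^ 2 / ε) := by
  have hLnn : 0 ≤ L := by rw [hL]; positivity
  have hAmeasF : ∀ t, MeasurableSet[ℱ t] (A t) := by
    intro t
    have hSm : MeasurableSet S := by
      rw [hS]
      exact (isClosed_le (by fun_prop) continuous_const).measurableSet
    have : A t = ⋂ i ∈ Set.Iic t, (θ i ⁻¹' S)ᶜ := by
      rw [hA]; ext ω; simp
    rw [this]
    refine MeasurableSet.biInter (Set.to_countable _) fun i hi => ?_
    exact (((hadapted i).mono (ℱ.mono hi)).measurable hSm).compl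
  have hAmeas : ∀ t, MeasurableSet (A t) := fun t => ℱ.le t _ (hAmeasF t)
  have hpE : ∀ t < T, ∫ ω, ‖p t ω‖ ∂μ ≤ η * v t := by
    intro t ht
    rw [← integral_condExp (ℱ.le t)]
    calc _ ≤ ∫ _, η * v t ∂μ :=
          integral_mono_ae integrable_condExp (integrable_const _) (hp t ht)
      _ = _ := by simp
  have hstep : ∀ t < T, ∫ ω, W (t + 1) (θ (t + 1) ω) (fun i => θ i ω) ∂μ
      ≤ ∫ ω, W t (θ t ω) (fun i => θ i ω) ∂μ + L * (η * v t) := by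
    intro t ht
    have h1 := hWint (t + 1) ht
    have h0 := hWint t ht.le
    have hY := hWint' t ht
    have hP := (hpint t ht).const_mul L
    have e1 : ∫ ω in A t, W (t + 1) (θ (t + 1) ω) (fun i => θ i ω) ∂μ
        ≤ ∫ ω in A t, W (t + 1) (θ t ω - η • gbar t ω) (fun i => θ i ω) ∂μ
          + ∫ ω in A t, L * ‖p t ω‖ ∂μ := by
      rw [← integral_add hY.integrableOn hP.integrableOn]
      refine integral_mono h1.integrableOn (hY.integrableOn.add hP.integrableOn) fun ω => ?_
      have := hlip t ht ω (θ t ω - η • gbar t ω) (θ (t + 1) ω)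
      have e : θ (t + 1) ω - (θ t ω - η • gbar t ω) = p t ω := by
        rw [hupdate t ht ω]; abel
      rw [e] at this
      have := (abs_le.1 this).2
      show _ ≤ _ + _
      linarith
    have e2 : ∫ ω in A t, W (t + 1) (θ t ω - η • gbar t ω) (fun i => θ i ω) ∂μ
        ≤ ∫ ω in A t, W t (θ t ω) (fun i => θ i ω) ∂μ := by
      rw [← setIntegral_condExp (ℱ.le t) hY (hAmeasF t)]
      exact setIntegral_mono_on_ae integrable_condExp.integrableOn h0.integrableOn
        (hAmeas t) (hsuper t ht)
    have e3 : ∫ ω in A t, L * ‖p t ω‖ ∂μ ≤ L * (η * v t) := by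
      calc _ ≤ ∫ ω, L * ‖p t ω‖ ∂μ :=
            setIntegral_le_integral hP (Filter.Eventually.of_forall fun ω => by
              show 0 ≤ L * ‖p t ω‖
              positivity)
        _ = L * ∫ ω, ‖p t ω‖ ∂μ := integral_const_mul _ _
        _ ≤ _ := mul_le_mul_of_nonneg_left (hpE t ht) hLnn
    have e4 : ∫ ω in (A t)ᶜ, W (t + 1) (θ (t + 1) ω) (fun i => θ i ω) ∂μ
        = ∫ ω in (A t)ᶜ, W t (θ t ω) (fun i => θ i ω) ∂μ :=
      setIntegral_congr_fun (hAmeas t).compl fun ω hω => hfreeze t ht ω hω _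
    rw [← integral_add_compl (hAmeas t) h1, ← integral_add_compl (hAmeas t) h0]
    linarith
  have hind : ∀ t ≤ T, ∫ ω, W t (θ t ω) (fun i => θ i ω) ∂μ
      ≤ ∫ ω, W 0 (θ 0 ω) (fun i => θ i ω) ∂μ + η * L * ∑ i ∈ Finset.range t, v i := by
    intro t
    induction t with
    | zero => intro _; simp
    | succ n ih =>
      intro h
      have a := ih (by omega)
      have b := hstep n (by omega)
      rw [Finset.sum_range_succ]
      linarith
  have hX0 : ∫ ω, W 0 (θ 0 ω) (fun i => θ i ω) ∂μ
      = ε / (2 * η * c * ε - η ^ 2 * G ^ 2) * Real.log (Real.exp 1 * ‖θs‖ ^ 2 / ε) := by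
    rw [integral_congr_ae (Filter.Eventually.of_forall hW0)]
    simp only [hθ0, zero_sub, norm_neg, integral_const, probReal_univ, one_smul]
  have hT' := hind T le_rfl
  rw [hX0] at hT'
  set C := η * L * ∑ t ∈ Finset.range T, v t with hC
  have hWT := hWint T le_rfl
  have hfin : (μ (A T)).toReal * ((T : ℝ) - C)
      ≤ ∫ ω, W T (θ T ω) (fun i => θ i ω) ∂μ - C := by
    have e1 : ∫ ω, (A T).indicator (fun _ => (T : ℝ) - C) ω ∂μ
        = (μ (A T)).toReal * ((T : ℝ) - C) := by
      rw [integral_indicator_const _ (hAmeas T)]; rfl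
    have e2 : ∫ ω, (W T (θ T ω) (fun i => θ i ω) - C) ∂μ
        = ∫ ω, W T (θ T ω) (fun i => θ i ω) ∂μ - C := by
      rw [integral_sub hWT (integrable_const _)]; simp
    rw [← e1, ← e2]
    refine integral_mono_ae ((integrable_const _).indicator (hAmeas T))
      (hWT.sub (integrable_const _)) ?_
    filter_upwards [hfloor] with ω hω
    by_cases h : ω ∈ A T
    · rw [Set.indicator_of_mem h]
      linarith [hrate ω h]
    · rw [Set.indicator_of_notMem h]
      linarith
  have key : (μ (A T)).toReal ≤ (ε / (2 * η * c * ε - η ^ 2 * G ^ 2)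
      * Real.log (Real.exp 1 * ‖θs‖ ^ 2 / ε)) / ((T : ℝ) - C) := by
    rw [le_div_iff₀ hpos]
    linarith
  refine key.trans (le_of_eq ?_)
  rw [← div_div]
  ring
end
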